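/- The leader's optimal signaling value dominates the Bayesian Stackelberg equilibrium value (Corollary): sSup (V^μ '' Π) ≥ sSup {∑ θ, μ θ * V̄ θ x | x ∈ Ξ}; that is, V_sigBSE ≥ V_BSE, where V_BSE is the supremum over mixed strategies x ∈ Ξ of the leader's expected payoff when every follower type best responds (with ties broken in the leader's favor) to the belief x. -/

import Mathlib

open Finset Set

attribute [local instance] Classical.propDecidable

noncomputable section

variable {M N K : ℕ}

/-- The belief space `Ξ` is the standard simplex; the best-response region `Ξ[θ,j]` consists of
the beliefs under which `j` is a best response for the type-`θ` follower. -/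
def XiBR (F : Fin K → Fin M → Fin N → ℝ) (θ : Fin K) (j : Fin N) : Set (Fin M → ℝ) :=
  {b | b ∈ stdSimplex ℝ (Fin M) ∧ ∀ j' : Fin N, ∑ i, b i * F θ i j' ≤ ∑ i, b i * F θ i j}

/-- The region `Ξ[𝐣] = ⋂ θ, Ξ[θ, 𝐣 θ]`. -/
def XiT (F : Fin K → Fin M → Fin N → ℝ) (js : Fin K → Fin N) : Set (Fin M → ℝ) :=
  ⋂ θ : Fin K, XiBR F θ (js θ)

/-- The follower's value function `F̄ θ b = max_j ∑ i, b i * F θ i j`. -/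
def Fbar (F : Fin K → Fin M → Fin N → ℝ) (θ : Fin K) (b : Fin M → ℝ) : ℝ :=
  ⨆ j : Fin N, ∑ i, b i * F θ i j

/-- The leader's (leader-favored tie-broken) value function `V̄ θ b`: the maximum of
`∑ i, b i * L i j` over the follower best responses `j` at belief `b`. -/
def Vbar (L : Fin M → Fin N → ℝ) (F : Fin K → Fin M → Fin N → ℝ) (θ : Fin K)
    (b : Fin M → ℝ) : ℝ :=
  sSup ((fun j => ∑ i, b i * L i j) '' {j : Fin N | ∑ i, b i * F θ i j = Fbar F θ b})

/-- The set of beliefs `Ξ̂`: the union over tuples `𝐣` of the extreme points of `Ξ[𝐣]`. -/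
def XiHat (F : Fin K → Fin M → Fin N → ℝ) : Set (Fin M → ℝ) :=
  ⋃ js : Fin K → Fin N, Set.extremePoints ℝ (XiT F js)

/-- A signaling assigns to each type a nonnegative finitely supported weight function on
beliefs, supported in the simplex, of total mass one. -/
def IsSignaling (π : Fin K → ((Fin M → ℝ) →₀ ℝ)) : Prop :=
  ∀ θ : Fin K, (∀ b, 0 ≤ π θ b) ∧ (((π θ).support : Set (Fin M → ℝ)) ⊆ stdSimplex ℝ (Fin M)) ∧
    ∑ b ∈ (π θ).support, π θ b = 1

/-- Consistency: all types' expected posterior beliefs coincide. -/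
def Consistent (π : Fin K → ((Fin M → ℝ) →₀ ℝ)) : Prop :=
  ∀ θ θ' : Fin K, ∀ i : Fin M,
    ∑ b ∈ (π θ).support, π θ b * b i = ∑ b ∈ (π θ').support, π θ' b * b i

/-- The set `Π` of consistent signalings. -/
def SigSet (M K : ℕ) : Set (Fin K → ((Fin M → ℝ) →₀ ℝ)) :=
  {π | IsSignaling π ∧ Consistent π}

/-- The set `Π̂` of consistent signalings supported on `Ξ̂`. -/
def SigSetHat (F : Fin K → Fin M → Fin N → ℝ) : Set (Fin K → ((Fin M → ℝ) →₀ ℝ)) :=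
  {π | π ∈ SigSet M K ∧ ∀ θ, ((π θ).support : Set (Fin M → ℝ)) ⊆ XiHat F}

/-- The follower's expected utility `U π θ̂ θ`. -/
def Usig (F : Fin K → Fin M → Fin N → ℝ) (π : Fin K → ((Fin M → ℝ) →₀ ℝ))
    (θhat θ : Fin K) : ℝ :=
  ∑ b ∈ (π θhat).support, π θhat b * Fbar F θ b

/-- The leader's expected utility `V π θ̂ θ`. -/
def Vsig (L : Fin M → Fin N → ℝ) (F : Fin K → Fin M → Fin N → ℝ)
    (π : Fin K → ((Fin M → ℝ) →₀ ℝ)) (θhat θ : Fin K) : ℝ :=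
  ∑ b ∈ (π θhat).support, π θhat b * Vbar L F θ b

/-- The follower's optimal reporting strategy `ψ θ π`: the least maximizer of `U π · θ`. -/
def psi (F : Fin K → Fin M → Fin N → ℝ) (π : Fin K → ((Fin M → ℝ) →₀ ℝ)) (θ : Fin K) :
    Fin K :=
  if h : (Finset.univ.filter fun θhat => ∀ β, Usig F π β θ ≤ Usig F π θhat θ).Nonempty then
    (Finset.univ.filter fun θhat => ∀ β, Usig F π β θ ≤ Usig F π θhat θ).min' h
  else θ

/-- The leader's expected utility `V^μ` under prior `μ`. -/
def Vmu (L : Fin M → Fin N → ℝ) (F : Fin K → Fin M → Fin N → ℝ) (μ : Fin K → ℝ)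
    (π : Fin K → ((Fin M → ℝ) →₀ ℝ)) : ℝ :=
  ∑ θ, μ θ * Vsig L F π (psi F π θ) θ

theorem Vbar_le_sum_abs (L : Fin M → Fin N → ℝ) (F : Fin K → Fin M → Fin N → ℝ) (θ : Fin K)
    {b : Fin M → ℝ} (hb : b ∈ stdSimplex ℝ (Fin M)) : Vbar L F θ b ≤ ∑ i, ∑ j, |L i j| := by
  refine Real.sSup_le ?_ (by positivity)
  rintro _ ⟨j, -, rfl⟩
  refine Finset.sum_le_sum fun i _ => ?_
  calc b i * L i j ≤ b i * |L i j| := mul_le_mul_of_nonneg_left (le_abs_self _) (hb.1 i)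
    _ ≤ 1 * |L i j| := by
        refine mul_le_mul_of_nonneg_right ?_ (abs_nonneg _)
        rw [← hb.2]
        exact Finset.single_le_sum (fun k _ => hb.1 k) (Finset.mem_univ i)
    _ ≤ ∑ j, |L i j| := by
        rw [one_mul]
        exact Finset.single_le_sum (f := fun j => |L i j|) (fun k _ => abs_nonneg _)
          (Finset.mem_univ j)

theorem Vsig_le_sum_abs (L : Fin M → Fin N → ℝ) (F : Fin K → Fin M → Fin N → ℝ)
    {π : Fin K → ((Fin M → ℝ) →₀ ℝ)} (hπ : IsSignaling π) (θhat θ : Fin K) :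
    Vsig L F π θhat θ ≤ ∑ i, ∑ j, |L i j| := by
  obtain ⟨hnonneg, hsupp, hsum⟩ := hπ θhat
  calc Vsig L F π θhat θ
      ≤ ∑ b ∈ (π θhat).support, π θhat b * ∑ i, ∑ j, |L i j| :=
        Finset.sum_le_sum fun b hb =>
          mul_le_mul_of_nonneg_left (Vbar_le_sum_abs L F θ (hsupp hb)) (hnonneg b)
    _ = ∑ i, ∑ j, |L i j| := by rw [← Finset.sum_mul, hsum, one_mul]

theorem bddAbove_Vmu_image_sigSet (L : Fin M → Fin N → ℝ) (F : Fin K → Fin M → Fin N → ℝ)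
    {μ : Fin K → ℝ} (hμ0 : ∀ θ, 0 ≤ μ θ) : BddAbove (Vmu L F μ '' SigSet M K) := by
  refine ⟨∑ θ, μ θ * ∑ i, ∑ j, |L i j|, ?_⟩
  rintro _ ⟨π, hπ, rfl⟩
  exact Finset.sum_le_sum fun θ _ =>
    mul_le_mul_of_nonneg_left (Vsig_le_sum_abs L F hπ.1 _ θ) (hμ0 θ)

/-- The uninformative signaling that sends every report to the belief `x` is consistent. -/
theorem const_single_mem_sigSet {x : Fin M → ℝ} (hx : x ∈ stdSimplex ℝ (Fin M)) :
    (fun _ => Finsupp.single x 1) ∈ SigSet M K := by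
  refine ⟨fun θ => ⟨fun b => ?_, ?_, ?_⟩, fun _ _ _ => rfl⟩
  · rw [Finsupp.single_apply]
    split_ifs <;> norm_num
  · simpa [Finsupp.support_single] using hx
  · simp

theorem Vmu_const_single (L : Fin M → Fin N → ℝ) (F : Fin K → Fin M → Fin N → ℝ)
    (μ : Fin K → ℝ) (x : Fin M → ℝ) :
    Vmu L F μ (fun _ => Finsupp.single x 1) = ∑ θ, μ θ * Vbar L F θ x := by
  simp [Vmu, Vsig]

/-- Corollary: the leader's optimal signaling value dominates the Bayesian
Stackelberg equilibrium value: `V_sigBSE ≥ V_BSE`. -/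
theorem sigBSE_ge_BSE (M N K : ℕ) (hM : 0 < M) (hN : 0 < N) (hK : 0 < K)
    (L : Fin M → Fin N → ℝ) (F : Fin K → Fin M → Fin N → ℝ)
    (μ : Fin K → ℝ) (hμ0 : ∀ θ, 0 ≤ μ θ) (hμ1 : ∑ θ, μ θ = 1) :
    sSup (Vmu L F μ '' SigSet M K) ≥
      sSup {r : ℝ | ∃ x ∈ stdSimplex ℝ (Fin M), r = ∑ θ, μ θ * Vbar L F θ x} := by
  have : NeZero M := ⟨hM.ne'⟩
  refine csSup_le ⟨_, Pi.single 0 1, single_mem_stdSimplex ℝ 0, rfl⟩ ?_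
  rintro _ ⟨x, hx, rfl⟩
  rw [← Vmu_const_single]
  exact le_csSup (bddAbove_Vmu_image_sigSet L F hμ0) ⟨_, const_single_mem_sigSet hx, rfl⟩

end
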